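/- Let E ⊂ (0,T) be a measurable set of positive measure and let ℓ be a density point of E (in the sense of Lebesgue). Then for each z > 1 there exists ℓ₁ ∈ (ℓ,T) such that the sequence {ℓ_m}_{m≥1} defined by ℓ_{m+1} = ℓ + z^{-m}(ℓ₁ − ℓ) satisfies ℓ_m − ℓ_{m+1} ≤ 3 |E ∩ (ℓ_{m+1}, ℓ_m)| for every m ≥ 1, where |·| denotes Lebesgue measure. -/

import Mathlib

open MeasureTheory Real Set Filter

/-- If `E` fills the proportion `c` of the symmetric interval of radius `h` about `x`, then it misses
at most measure `2 * h * (1 - c)` of every right end `(x + a, x + h)` of that interval. -/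
lemma le_measureReal_inter_Ioo_of_symmetric_density {E : Set ℝ} {x a h c : ℝ}
    (hc : 0 ≤ c) (ha : 0 ≤ a) (hah : a ≤ h)
    (hE : ENNReal.ofReal c ≤ volume (E ∩ Ioo (x - h) (x + h)) / ENNReal.ofReal (2 * h)) :
    h - a - 2 * h * (1 - c) ≤ (volume (E ∩ Ioo (x + a) (x + h))).toReal := by
  have hfin : volume (E ∩ Ioo (x + a) (x + h)) ≠ ⊤ :=
    measure_ne_top_of_subset inter_subset_right measure_Ioo_lt_top.ne
  have hsub : E ∩ Ioo (x - h) (x + h) ⊆ Ioc (x - h) (x + a) ∪ E ∩ Ioo (x + a) (x + h) := by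
    rintro y ⟨hyE, hy⟩
    rcases le_or_gt y (x + a) with hya | hya
    · exact Or.inl ⟨hy.1, hya⟩
    · exact Or.inr ⟨hyE, hya, hy.2⟩
  have hle : ENNReal.ofReal (c * (2 * h)) ≤
      ENNReal.ofReal (h + a + (volume (E ∩ Ioo (x + a) (x + h))).toReal) := by
    calc ENNReal.ofReal (c * (2 * h)) = ENNReal.ofReal c * ENNReal.ofReal (2 * h) :=
          ENNReal.ofReal_mul hc
      _ ≤ volume (E ∩ Ioo (x - h) (x + h)) := ENNReal.mul_le_of_le_div hE
      _ ≤ volume (Ioc (x - h) (x + a)) + volume (E ∩ Ioo (x + a) (x + h)) :=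
          (measure_mono hsub).trans (measure_union_le _ _)
      _ = ENNReal.ofReal (h + a + (volume (E ∩ Ioo (x + a) (x + h))).toReal) := by
          rw [Real.volume_Ioc, ENNReal.ofReal_add (by linarith) ENNReal.toReal_nonneg,
            ENNReal.ofReal_toReal hfin]
          congr 2
          ring
  have hreal := (ENNReal.ofReal_le_ofReal_iff
    (add_nonneg (by linarith) ENNReal.toReal_nonneg)).1 hle
  linarith

/-- **Lemma (telescoping sequence adapted to a density point).**
Let `E ⊆ (0,T)` be measurable with positive measure and let `ℓ` be a density
point of `E`. Then for each `z > 1` there exists `ℓ₁ ∈ (ℓ,T)` such that the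
sequence `ℓ_m = ℓ + z^{-(m-1)}(ℓ₁ − ℓ)` (i.e. `ℓ_{m+1} = ℓ + z^{-m}(ℓ₁ − ℓ)`)
satisfies `ℓ_m − ℓ_{m+1} ≤ 3 |E ∩ (ℓ_{m+1}, ℓ_m)|` for every `m ≥ 1`. -/
theorem density_point_telescoping_sequence
    (T : ℝ) (hT : 0 < T)
    (E : Set ℝ) (hEm : MeasurableSet E) (hET : E ⊆ Ioo 0 T) (hEpos : 0 < volume E)
    (ℓ : ℝ) (hℓ : ℓ ∈ Ioo 0 T)
    (hdens : Tendsto (fun h : ℝ => volume (E ∩ Ioo (ℓ - h) (ℓ + h)) / ENNReal.ofReal (2 * h))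
      (nhdsWithin 0 (Ioi 0)) (nhds 1))
    (z : ℝ) (hz : 1 < z) :
    ∃ ℓ₁ ∈ Ioo ℓ T, ∀ m : ℕ, 1 ≤ m →
      (ℓ + (ℓ₁ - ℓ) * z ^ (1 - (m : ℤ))) - (ℓ + (ℓ₁ - ℓ) * z ^ (-(m : ℤ))) ≤
        3 * (volume (E ∩ Ioo (ℓ + (ℓ₁ - ℓ) * z ^ (-(m : ℤ)))
          (ℓ + (ℓ₁ - ℓ) * z ^ (1 - (m : ℤ))))).toReal := by
  have hz0 : 0 < z := one_pos.trans hz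
  have hzinv : 0 < z⁻¹ := inv_pos.2 hz0
  have hzinv1 : z⁻¹ < 1 := inv_lt_one_of_one_lt₀ hz
  have hlt : ENNReal.ofReal (1 - (1 - z⁻¹) / 3) < 1 := by
    rw [ENNReal.ofReal_lt_one]
    linarith
  obtain ⟨δ, hδ, hdens_lt⟩ := mem_nhdsGT_iff_exists_Ioo_subset.1 (hdens.eventually_const_lt hlt)
  have hδ : 0 < δ := hδ
  obtain ⟨r, hr0, hr⟩ := exists_between (lt_min hδ (sub_pos.2 hℓ.2))
  obtain ⟨hrδ, hrT⟩ := lt_min_iff.1 hr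
  refine ⟨ℓ + r, ⟨by linarith, by linarith⟩, fun m hm => ?_⟩
  rw [add_sub_cancel_left]
  set h := r * z ^ (1 - (m : ℤ)) with hh
  have hpow : r * z ^ (-(m : ℤ)) = h * z⁻¹ := by
    rw [hh, mul_assoc, ← zpow_sub_one₀ hz0.ne']
    congr 2
    ring
  have hh0 : 0 < h := by positivity
  have hhr : h ≤ r := mul_le_of_le_one_right hr0.le (zpow_le_one_of_nonpos₀ hz.le (by lia))
  rw [hpow]
  have key := le_measureReal_inter_Ioo_of_symmetric_density (a := h * z⁻¹) (by linarith)
    (by positivity) (mul_le_of_le_one_right hh0.le hzinv1.le)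
    (hdens_lt ⟨hh0, hhr.trans_lt hrδ⟩ : ENNReal.ofReal (1 - (1 - z⁻¹) / 3) < _).le
  linarith
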